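/- arXiv:2405.04205 — 2 statements merged into one kernel-verified Lean document; each statement's English description precedes it below -/
import Mathlib

section
/- dNLS normal form for the Salerno model: there exist constants C₀ > 0 and ρ₀ > 0 (depending on ν, γ, N) such that for all 0 < ρ ≤ ρ₀ and all ε ∈ (0,1], the transformed Salerno Hamiltonian K = H ∘ Φ satisfies sup over the ball {(x,y) ∈ ℝ^N×ℝ^N : ‖(x,y)‖ ≤ ρ} of |K(x,y) − Z⁽⁰⁾(x,y)| ≤ C₀ · ν · ρ⁴ · (ρ² + ε), where Z⁽⁰⁾(x,y) = Σ_j [ (γ/8)(x_j²+y_j²)² + ε(x_{j+1}x_j + y_{j+1}y_j) ] is the dNLS Hamiltonian. -/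
/-- `σ(s) = √((exp s − 1)/s)` for `s ≠ 0`, `σ(0) = 1`. -/
noncomputable def sigmaFun (s : ℝ) : ℝ :=
  if s = 0 then 1 else Real.sqrt ((Real.exp s - 1) / s)

/-- The Salerno Hamiltonian in Cartesian coordinates on the periodic lattice `ℤ/N`. -/
noncomputable def salernoH (ν γ ε : ℝ) (N : ℕ) [NeZero N] (q p : ZMod N → ℝ) : ℝ :=
  (∑ j : ZMod N, (-(γ / (4 * ν ^ 2)) * Real.log (1 + ν * ((q j) ^ 2 + (p j) ^ 2))
      + γ / (4 * ν) * ((q j) ^ 2 + (p j) ^ 2)))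
  + ε * ∑ j : ZMod N, (q (j + 1) * q j + p (j + 1) * p j)

/-- The componentwise Darboux transformation `Φ`, first component `q_j`. -/
noncomputable def Qmap (ν : ℝ) {N : ℕ} (x y : ZMod N → ℝ) : ZMod N → ℝ :=
  fun j => x j * sigmaFun (ν * ((x j) ^ 2 + (y j) ^ 2))

/-- The componentwise Darboux transformation `Φ`, second component `p_j`. -/
noncomputable def Pmap (ν : ℝ) {N : ℕ} (x y : ZMod N → ℝ) : ZMod N → ℝ :=
  fun j => y j * sigmaFun (ν * ((x j) ^ 2 + (y j) ^ 2))

/-- The dNLS Hamiltonian `Z⁽⁰⁾`. -/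
noncomputable def Z0 (γ ε : ℝ) (N : ℕ) [NeZero N] (x y : ZMod N → ℝ) : ℝ :=
  ∑ j : ZMod N, (γ / 8 * ((x j) ^ 2 + (y j) ^ 2) ^ 2
    + ε * (x (j + 1) * x j + y (j + 1) * y j))

lemma sigmaFun_nonneg (s : ℝ) : 0 ≤ sigmaFun s := by
  unfold sigmaFun
  split_ifs
  · exact zero_le_one
  · exact Real.sqrt_nonneg _

lemma mul_sigmaFun_sq {s : ℝ} (hs : 0 ≤ s) : s * sigmaFun s ^ 2 = Real.exp s - 1 := by
  unfold sigmaFun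
  split_ifs with h
  · simp [h]
  · rw [Real.sq_sqrt (div_nonneg (by linarith [Real.add_one_le_exp s]) hs)]
    field_simp

lemma one_le_sigmaFun_sq {s : ℝ} (hs : 0 ≤ s) : 1 ≤ sigmaFun s ^ 2 := by
  rcases hs.eq_or_lt with rfl | h
  · simp [sigmaFun]
  · have := mul_sigmaFun_sq hs
    have := Real.add_one_le_exp s
    exact le_of_mul_le_mul_left (by linarith) h

lemma sigmaFun_sq_le {s : ℝ} (hs : 0 ≤ s) (hs1 : s ≤ 1) : sigmaFun s ^ 2 ≤ 1 + s := by
  rcases hs.eq_or_lt with rfl | h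
  · simp [sigmaFun]
  · have := mul_sigmaFun_sq hs
    have := abs_le.mp (Real.abs_exp_sub_one_sub_id_le (x := s) (by rwa [abs_of_nonneg hs]))
    exact le_of_mul_le_mul_left (by nlinarith) h

lemma abs_sigmaFun_mul_sub_one_le {s t u : ℝ} (hs : 0 ≤ s) (ht : 0 ≤ t) (hsu : s ≤ u)
    (htu : t ≤ u) (hu : u ≤ 1) : |sigmaFun s * sigmaFun t - 1| ≤ u := by
  have hs1 : 1 ≤ sigmaFun s := by
    nlinarith [one_le_sigmaFun_sq hs, sigmaFun_nonneg s]
  have ht1 : 1 ≤ sigmaFun t := by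
    nlinarith [one_le_sigmaFun_sq ht, sigmaFun_nonneg t]
  have hs2 := sigmaFun_sq_le hs (hsu.trans hu)
  have ht2 := sigmaFun_sq_le ht (htu.trans hu)
  rw [abs_le]
  constructor <;> nlinarith [sq_nonneg (sigmaFun s - sigmaFun t)]

lemma abs_exp_sub_quadratic_le {s : ℝ} (hs : 0 ≤ s) (hs1 : s ≤ 1) :
    |Real.exp s - 1 - s - s ^ 2 / 2| ≤ s ^ 3 := by
  have h := Real.exp_bound (x := s) (by rwa [abs_of_nonneg hs]) (n := 3) (by norm_num)
  rw [abs_of_nonneg hs] at h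
  norm_num [Finset.sum_range_succ, Nat.factorial] at h
  have h3 : 0 ≤ s ^ 3 := by positivity
  calc |Real.exp s - 1 - s - s ^ 2 / 2| = |Real.exp s - (1 + s + s ^ 2 / 2)| := by
        congr 1; ring
    _ ≤ s ^ 3 := by linarith

lemma onsite_transformed {ν : ℝ} (hν : 0 < ν) (γ a b : ℝ) :
    -(γ / (4 * ν ^ 2)) * Real.log (1 + ν * ((a * sigmaFun (ν * (a ^ 2 + b ^ 2))) ^ 2
        + (b * sigmaFun (ν * (a ^ 2 + b ^ 2))) ^ 2))
      + γ / (4 * ν) * ((a * sigmaFun (ν * (a ^ 2 + b ^ 2))) ^ 2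
        + (b * sigmaFun (ν * (a ^ 2 + b ^ 2))) ^ 2) - γ / 8 * (a ^ 2 + b ^ 2) ^ 2
    = γ / (4 * ν ^ 2) * (Real.exp (ν * (a ^ 2 + b ^ 2)) - 1 - ν * (a ^ 2 + b ^ 2)
        - (ν * (a ^ 2 + b ^ 2)) ^ 2 / 2) := by
  have h := mul_sigmaFun_sq (s := ν * (a ^ 2 + b ^ 2)) (by positivity)
  set σ := sigmaFun (ν * (a ^ 2 + b ^ 2))
  have h1 : (a * σ) ^ 2 + (b * σ) ^ 2 = (Real.exp (ν * (a ^ 2 + b ^ 2)) - 1) / ν := by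
    rw [← h]
    field_simp
  have h2 : 1 + ν * ((Real.exp (ν * (a ^ 2 + b ^ 2)) - 1) / ν)
      = Real.exp (ν * (a ^ 2 + b ^ 2)) := by
    field_simp
    ring
  rw [h1, h2, Real.log_exp]
  field_simp
  ring

lemma abs_onsite_le {ν R : ℝ} (hν : 0 < ν) (γ a b : ℝ) (hR : a ^ 2 + b ^ 2 ≤ R)
    (hνR : ν * R ≤ 1) :
    |γ / (4 * ν ^ 2) * (Real.exp (ν * (a ^ 2 + b ^ 2)) - 1 - ν * (a ^ 2 + b ^ 2)
        - (ν * (a ^ 2 + b ^ 2)) ^ 2 / 2)| ≤ |γ| * ν * R ^ 3 := by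
  have hs : ν * (a ^ 2 + b ^ 2) ≤ ν * R := by gcongr
  have h := abs_exp_sub_quadratic_le (s := ν * (a ^ 2 + b ^ 2)) (by positivity) (hs.trans hνR)
  have hR0 : 0 ≤ R := le_trans (by positivity) hR
  rw [abs_mul, abs_div, abs_of_pos (by positivity : 0 < 4 * ν ^ 2)]
  calc _ ≤ |γ| / (4 * ν ^ 2) * (ν * R) ^ 3 := by gcongr; exact h.trans (by gcongr)
    _ = |γ| * ν * R ^ 3 / 4 := by field_simp
    _ ≤ |γ| * ν * R ^ 3 := div_le_self (by positivity) (by norm_num)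

lemma abs_coupling_le {ν R : ℝ} (hν : 0 < ν) {a b c d : ℝ} (h1 : a ^ 2 + b ^ 2 ≤ R)
    (h2 : c ^ 2 + d ^ 2 ≤ R) (hνR : ν * R ≤ 1) :
    |(a * c + b * d) * (sigmaFun (ν * (a ^ 2 + b ^ 2)) * sigmaFun (ν * (c ^ 2 + d ^ 2)) - 1)|
      ≤ ν * R ^ 2 := by
  have hR0 : 0 ≤ R := le_trans (by positivity) h1
  have hdot : |a * c + b * d| ≤ R := by
    rw [abs_le]
    constructor <;> nlinarith [sq_nonneg (a - c), sq_nonneg (b - d), sq_nonneg (a + c),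
      sq_nonneg (b + d)]
  have hσ := abs_sigmaFun_mul_sub_one_le (s := ν * (a ^ 2 + b ^ 2)) (t := ν * (c ^ 2 + d ^ 2))
    (by positivity) (by positivity) (mul_le_mul_of_nonneg_left h1 hν.le)
    (mul_le_mul_of_nonneg_left h2 hν.le) hνR
  rw [abs_mul]
  calc _ ≤ R * (ν * R) := by gcongr
    _ = ν * R ^ 2 := by ring

lemma salernoH_sub_Z0 {ν : ℝ} (hν : 0 < ν) (γ ε : ℝ) (N : ℕ) [NeZero N] (x y : ZMod N → ℝ) :
    salernoH ν γ ε N (Qmap ν x y) (Pmap ν x y) - Z0 γ ε N x y =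
      ∑ j : ZMod N, (γ / (4 * ν ^ 2) * (Real.exp (ν * (x j ^ 2 + y j ^ 2)) - 1
          - ν * (x j ^ 2 + y j ^ 2) - (ν * (x j ^ 2 + y j ^ 2)) ^ 2 / 2)
        + ε * ((x (j + 1) * x j + y (j + 1) * y j)
          * (sigmaFun (ν * (x (j + 1) ^ 2 + y (j + 1) ^ 2))
            * sigmaFun (ν * (x j ^ 2 + y j ^ 2)) - 1))) := by
  unfold salernoH Z0 Qmap Pmap
  rw [Finset.mul_sum, ← Finset.sum_add_distrib, ← Finset.sum_sub_distrib]
  refine Finset.sum_congr rfl fun j _ => ?_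
  rw [← onsite_transformed hν]
  ring

/-- dNLS normal form of the Salerno model: `|H∘Φ − Z⁽⁰⁾| ≤ C₀·ν·ρ⁴·(ρ²+ε)` on the
ball of radius `ρ ≤ ρ₀`, for all `ε ∈ (0,1]`. -/
theorem stmt12 (ν γ : ℝ) (hν : 0 < ν) (N : ℕ) [NeZero N] (hN : 2 ≤ N) :
    ∃ C₀ > (0 : ℝ), ∃ ρ₀ > (0 : ℝ), ∀ ρ : ℝ, 0 < ρ → ρ ≤ ρ₀ →
      ∀ ε : ℝ, 0 < ε → ε ≤ 1 →
        ∀ x y : ZMod N → ℝ, Real.sqrt (∑ j : ZMod N, ((x j) ^ 2 + (y j) ^ 2)) ≤ ρ →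
          |salernoH ν γ ε N (Qmap ν x y) (Pmap ν x y) - Z0 γ ε N x y|
            ≤ C₀ * ν * ρ ^ 4 * (ρ ^ 2 + ε) := by
  have hN0 : (0 : ℝ) < N := by exact_mod_cast (by omega : 0 < N)
  refine ⟨N * (|γ| + 1), by positivity, 1 / √ν, by positivity, ?_⟩
  intro ρ hρ hρ₀ ε hε _ x y hxy
  have hνρ : ν * ρ ^ 2 ≤ 1 := by
    have := pow_le_pow_left₀ hρ.le hρ₀ 2
    rw [div_pow, Real.sq_sqrt hν.le, one_pow, le_div_iff₀ hν] at this
    linarith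
  have hsite : ∀ j, x j ^ 2 + y j ^ 2 ≤ ρ ^ 2 := fun j =>
    (Finset.single_le_sum (f := fun j => x j ^ 2 + y j ^ 2) (fun i _ => by positivity)
      (Finset.mem_univ j)).trans ((Real.sqrt_le_left hρ.le).mp hxy)
  rw [salernoH_sub_Z0 hν]
  calc _ ≤ ∑ j : ZMod N, (|γ| * ν * (ρ ^ 2) ^ 3 + ε * (ν * (ρ ^ 2) ^ 2)) := by
        refine (Finset.abs_sum_le_sum_abs _ _).trans (Finset.sum_le_sum fun j _ => ?_)
        refine (abs_add_le _ _).trans (add_le_add (abs_onsite_le hν γ _ _ (hsite j) hνρ) ?_)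
        rw [abs_mul, abs_of_pos hε]
        exact mul_le_mul_of_nonneg_left
          (abs_coupling_le hν (hsite (j + 1)) (hsite j) hνρ) hε.le
    _ = N * (ν * ρ ^ 4 * (|γ| * ρ ^ 2 + ε)) := by
        rw [Finset.sum_const, Finset.card_univ, ZMod.card, nsmul_eq_mul]
        ring
    _ ≤ N * (ν * ρ ^ 4 * ((|γ| + 1) * (ρ ^ 2 + ε))) := by
        gcongr
        nlinarith [mul_nonneg (abs_nonneg γ) hε.le, sq_nonneg ρ]
    _ = N * (|γ| + 1) * ν * ρ ^ 4 * (ρ ^ 2 + ε) := by ring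
end

section
/- Closeness of the Ablowitz-Ladik dynamics to the dNLS dynamics in Darboux coordinates: there exist constants c₀' > 0 and ρ₀ > 0 (depending on ν, N) such that for all 0 < ρ ≤ ρ₀, all ε ∈ (0,1], and all solutions z : ℝ → ℝ^{2N} of ż = J∇K(z) and ζ : ℝ → ℝ^{2N} of ζ̇ = J∇Z(ζ) with ‖z(0)‖ ≤ ρ and ‖ζ(0)‖ ≤ ρ, one has ‖z(t) − ζ(t)‖ ≤ c₀'·(‖z(0) − ζ(0)‖ + ρ³/ε) for all times |t| ≤ ε⁻¹. -/
/-- The Ablowitz-Ladik Hamiltonian in Cartesian coordinates on the periodic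
lattice `ℤ/N`. -/
noncomputable def alH (ε : ℝ) (N : ℕ) [NeZero N] (q p : ZMod N → ℝ) : ℝ :=
  ε * ∑ j : ZMod N, (q (j + 1) * q j + p (j + 1) * p j)

/-- The transformed Ablowitz-Ladik Hamiltonian `K = H ∘ Φ`, with `Φ` the
componentwise Darboux transformation. -/
noncomputable def Kal (ν ε : ℝ) (N : ℕ) [NeZero N]
    (z : (ZMod N → ℝ) × (ZMod N → ℝ)) : ℝ :=
  alH ε N
    (fun j => z.1 j * sigmaFun (ν * ((z.1 j) ^ 2 + (z.2 j) ^ 2)))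
    (fun j => z.2 j * sigmaFun (ν * ((z.1 j) ^ 2 + (z.2 j) ^ 2)))

/-- The dNLS hopping Hamiltonian `Z` on `(ZMod N → ℝ) × (ZMod N → ℝ)`. -/
noncomputable def Zham (ε : ℝ) (N : ℕ) [NeZero N]
    (z : (ZMod N → ℝ) × (ZMod N → ℝ)) : ℝ :=
  ε * ∑ j : ZMod N, (z.1 (j + 1) * z.1 j + z.2 (j + 1) * z.2 j)

/-- `(Q,P) : ℝ → ℝ^N × ℝ^N` solves the Hamilton equations `ż = J∇F(z)`, i.e.
`q̇_j = ∂F/∂p_j`, `ṗ_j = −∂F/∂q_j`. -/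
def IsHamSol {N : ℕ} [NeZero N] (F : (ZMod N → ℝ) × (ZMod N → ℝ) → ℝ)
    (Q P : ℝ → ZMod N → ℝ) : Prop :=
  ∀ t : ℝ, ∀ j : ZMod N,
    HasDerivAt (fun s => Q s j) (fderiv ℝ F (Q t, P t) (0, Pi.single j 1)) t ∧
    HasDerivAt (fun s => P s j) (-(fderiv ℝ F (Q t, P t) (Pi.single j 1, 0))) t


theorem sigmaFun_eq_sqrt_dslope : sigmaFun = fun s => √(dslope Real.exp 0 s) := by
  funext s
  unfold sigmaFun
  split_ifs with h
  · simp [h]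
  · rw [dslope_of_ne _ h, slope_def_field]; simp

theorem dslope_exp_pos (s : ℝ) : 0 < dslope Real.exp 0 s := by
  by_cases h : s = 0
  · simp [h]
  · rw [dslope_of_ne _ h, slope_def_field]
    rcases lt_or_gt_of_ne h with h | h
    · exact div_pos_of_neg_of_neg (sub_neg.2 (Real.exp_lt_exp.2 h)) (by linarith)
    · exact div_pos (sub_pos.2 (Real.exp_lt_exp.2 h)) (by linarith)

theorem analyticAt_dslope_exp_zero : AnalyticAt ℝ (dslope Real.exp 0) 0 := by
  obtain ⟨p, hp⟩ : AnalyticAt ℝ Real.exp 0 := by fun_prop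
  exact ⟨_, hp.has_fpower_series_dslope_fslope⟩

theorem differentiable_sigmaFun : Differentiable ℝ sigmaFun := by
  intro s
  rw [sigmaFun_eq_sqrt_dslope]
  refine DifferentiableAt.sqrt ?_ (dslope_exp_pos s).ne'
  by_cases h : s = 0
  · exact h ▸ analyticAt_dslope_exp_zero.differentiableAt
  · exact (differentiableAt_dslope_of_ne h).2 Real.differentiableAt_exp

theorem contDiffAt_sigmaFun_zero : ContDiffAt ℝ 1 sigmaFun 0 := by
  rw [sigmaFun_eq_sqrt_dslope]
  exact analyticAt_dslope_exp_zero.contDiffAt.sqrt (dslope_exp_pos 0).ne'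

theorem exists_sigmaFun_bounds : ∃ δ > (0 : ℝ), ∃ C > (0 : ℝ), ∀ s : ℝ, |s| < δ →
    |sigmaFun s - 1| ≤ C * |s| ∧ |deriv sigmaFun s| ≤ C := by
  obtain ⟨C, t, ht, hL⟩ := contDiffAt_sigmaFun_zero.exists_lipschitzOnWith
  obtain ⟨δ, hδ, hball⟩ := Metric.mem_nhds_iff.1 ht
  refine ⟨δ, hδ, C + 1, by positivity, fun s hs => ⟨?_, ?_⟩⟩
  · have h := hL.dist_le_mul s (hball (by simpa using hs)) 0 (mem_of_mem_nhds ht)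
    rw [show sigmaFun 0 = 1 by simp [sigmaFun]] at h
    simp only [Real.dist_eq, sub_zero] at h
    nlinarith [abs_nonneg s]
  · have hs' : t ∈ nhds s :=
      Filter.mem_of_superset (Metric.isOpen_ball.mem_nhds (by simpa using hs)) hball
    have h := norm_deriv_le_of_lipschitzOn hs' hL
    rw [Real.norm_eq_abs] at h
    linarith

section

variable {N : ℕ} [NeZero N]

theorem differentiable_Kal (ν ε : ℝ) : Differentiable ℝ (Kal ν ε N) := by
  have := differentiable_sigmaFun
  unfold Kal alH
  fun_prop

theorem differentiable_Zham (ε : ℝ) : Differentiable ℝ (Zham ε N) := by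
  unfold Zham
  fun_prop

theorem fderiv_Zham_apply (ε : ℝ) (z w : (ZMod N → ℝ) × (ZMod N → ℝ)) :
    fderiv ℝ (Zham ε N) z w = ε * ∑ j : ZMod N,
      (w.1 (j + 1) * z.1 j + z.1 (j + 1) * w.1 j + (w.2 (j + 1) * z.2 j + z.2 (j + 1) * w.2 j)) := by
  have h1 : HasDerivAt (fun t : ℝ => z + t • w) w 0 := by
    simpa using ((hasDerivAt_id (0 : ℝ)).smul_const w).const_add z
  have h2 := (by simpa using (differentiable_Zham ε z).hasFDerivAt :
    HasFDerivAt (Zham ε N) (fderiv ℝ (Zham ε N) z) (z + (0 : ℝ) • w)).comp_hasDerivAt 0 h1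
  refine h2.unique ?_
  have hq (j : ZMod N) : HasDerivAt (fun t : ℝ => z.1 j + t * w.1 j) (w.1 j) 0 := by
    simpa using ((hasDerivAt_id (0 : ℝ)).mul_const (w.1 j)).const_add (z.1 j)
  have hp (j : ZMod N) : HasDerivAt (fun t : ℝ => z.2 j + t * w.2 j) (w.2 j) 0 := by
    simpa using ((hasDerivAt_id (0 : ℝ)).mul_const (w.2 j)).const_add (z.2 j)
  have h3 := (HasDerivAt.fun_sum (u := Finset.univ) fun (j : ZMod N) _ =>
    ((hq (j + 1)).mul (hq j)).add ((hp (j + 1)).mul (hp j))).const_mul ε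
  refine (h3.congr_deriv ?_).congr_of_eventuallyEq (Filter.Eventually.of_forall fun t => ?_)
  · simp
  · simp [Zham]

/-- The derivative at `(q, p)` in direction `(a, b)` of the first component
`q σ(ν(q² + p²))` of `φ⁻¹`. -/
noncomputable def dphi (ν q p a b : ℝ) : ℝ :=
  a * sigmaFun (ν * (q ^ 2 + p ^ 2)) +
    q * (deriv sigmaFun (ν * (q ^ 2 + p ^ 2)) * (ν * (2 * q * a + 2 * p * b)))

theorem hasDerivAt_phi (ν q p a b : ℝ) :
    HasDerivAt (fun t : ℝ => (q + t * a) * sigmaFun (ν * ((q + t * a) ^ 2 + (p + t * b) ^ 2)))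
      (dphi ν q p a b) 0 := by
  have hq : HasDerivAt (fun t : ℝ => q + t * a) a 0 := by
    simpa using ((hasDerivAt_id (0 : ℝ)).mul_const a).const_add q
  have hp : HasDerivAt (fun t : ℝ => p + t * b) b 0 := by
    simpa using ((hasDerivAt_id (0 : ℝ)).mul_const b).const_add p
  have hr := ((hq.pow 2).add (hp.pow 2)).const_mul ν
  have hs := HasDerivAt.comp (0 : ℝ) (differentiable_sigmaFun _).hasDerivAt hr
  refine ((hq.mul hs).congr_deriv ?_).congr_of_eventuallyEq
    (Filter.Eventually.of_forall fun t => ?_)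
  · simp [dphi]
  · simp

theorem fderiv_Kal_apply (ν ε : ℝ) (z w : (ZMod N → ℝ) × (ZMod N → ℝ)) :
    fderiv ℝ (Kal ν ε N) z w = ε * ∑ j : ZMod N,
      (dphi ν (z.1 (j + 1)) (z.2 (j + 1)) (w.1 (j + 1)) (w.2 (j + 1)) *
          (z.1 j * sigmaFun (ν * (z.1 j ^ 2 + z.2 j ^ 2))) +
        z.1 (j + 1) * sigmaFun (ν * (z.1 (j + 1) ^ 2 + z.2 (j + 1) ^ 2)) *
          dphi ν (z.1 j) (z.2 j) (w.1 j) (w.2 j) +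
        (dphi ν (z.2 (j + 1)) (z.1 (j + 1)) (w.2 (j + 1)) (w.1 (j + 1)) *
          (z.2 j * sigmaFun (ν * (z.1 j ^ 2 + z.2 j ^ 2))) +
        z.2 (j + 1) * sigmaFun (ν * (z.1 (j + 1) ^ 2 + z.2 (j + 1) ^ 2)) *
          dphi ν (z.2 j) (z.1 j) (w.2 j) (w.1 j))) := by
  have h1 : HasDerivAt (fun t : ℝ => z + t • w) w 0 := by
    simpa using ((hasDerivAt_id (0 : ℝ)).smul_const w).const_add z
  have h2 := (by simpa using (differentiable_Kal ν ε z).hasFDerivAt :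
    HasFDerivAt (Kal ν ε N) (fderiv ℝ (Kal ν ε N) z) (z + (0 : ℝ) • w)).comp_hasDerivAt 0 h1
  refine h2.unique ?_
  have hq (j : ZMod N) := hasDerivAt_phi ν (z.1 j) (z.2 j) (w.1 j) (w.2 j)
  have hp (j : ZMod N) := hasDerivAt_phi ν (z.2 j) (z.1 j) (w.2 j) (w.1 j)
  have h3 := (HasDerivAt.fun_sum (u := Finset.univ) fun (j : ZMod N) _ =>
    ((hq (j + 1)).mul (hq j)).add ((hp (j + 1)).mul (hp j))).const_mul ε
  refine (h3.congr_deriv ?_).congr_of_eventuallyEq (Filter.Eventually.of_forall fun t => ?_)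
  · simp [add_comm (z.2 _ ^ 2)]
  · simp [Kal, alH, add_comm ((z.2 _ + _) ^ 2)]

theorem fderiv_Kal_rotation (ν ε : ℝ) (q p : ZMod N → ℝ) :
    fderiv ℝ (Kal ν ε N) (q, p) (-p, q) = 0 := by
  rw [fderiv_Kal_apply]
  refine mul_eq_zero_of_right _ (Finset.sum_eq_zero fun j _ => ?_)
  simp only [dphi, Pi.neg_apply, add_comm (p _ ^ 2)]
  ring

theorem sum_sq_eq_of_isHamSol {F : (ZMod N → ℝ) × (ZMod N → ℝ) → ℝ}
    (hF : ∀ q p, fderiv ℝ F (q, p) (-p, q) = 0) {Q P : ℝ → ZMod N → ℝ} (h : IsHamSol F Q P)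
    (t : ℝ) : ∑ j, (Q t j ^ 2 + P t j ^ 2) = ∑ j, (Q 0 j ^ 2 + P 0 j ^ 2) := by
  have hd (t : ℝ) : HasDerivAt (fun t => ∑ j, (Q t j ^ 2 + P t j ^ 2)) 0 t := by
    have h3 := HasDerivAt.fun_sum (u := Finset.univ) fun (j : ZMod N) _ =>
      ((h t j).1.pow 2).add ((h t j).2.pow 2)
    refine (h3.congr_deriv ?_).congr_of_eventuallyEq
      (Filter.Eventually.of_forall fun t => by simp)
    have hw : ((-P t, Q t) : (ZMod N → ℝ) × (ZMod N → ℝ)) =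
        ∑ j, (Q t j • ((0 : ZMod N → ℝ), (Pi.single j 1 : ZMod N → ℝ)) -
          P t j • ((Pi.single j 1 : ZMod N → ℝ), (0 : ZMod N → ℝ))) := by
      ext i <;> simp [Prod.fst_sum, Prod.snd_sum, Finset.sum_apply, Pi.single_apply]
    have h0 := hF (Q t) (P t)
    rw [hw, map_sum] at h0
    simp only [map_sub, map_smul, smul_eq_mul] at h0
    refine Eq.trans ?_ ((congrArg (2 * ·) h0).trans (mul_zero _))
    simp only [Finset.mul_sum]
    exact Finset.sum_congr rfl fun j _ => by push_cast; ring
  exact is_const_of_deriv_eq_zero (fun t => (hd t).differentiableAt) (fun t => (hd t).deriv) t 0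

/-- The Hamiltonian vector field `J∇F`. -/
noncomputable def hamField (F : (ZMod N → ℝ) × (ZMod N → ℝ) → ℝ)
    (z : (ZMod N → ℝ) × (ZMod N → ℝ)) : (ZMod N → ℝ) × (ZMod N → ℝ) :=
  (fun j => fderiv ℝ F z (0, Pi.single j 1), fun j => -fderiv ℝ F z (Pi.single j 1, 0))

theorem IsHamSol.hasDerivAt {F : (ZMod N → ℝ) × (ZMod N → ℝ) → ℝ} {Q P : ℝ → ZMod N → ℝ}
    (h : IsHamSol F Q P) (t : ℝ) :
    HasDerivAt (fun t => (Q t, P t)) (hamField F (Q t, P t)) t :=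
  (hasDerivAt_pi.2 fun j => (h t j).1).prodMk (hasDerivAt_pi.2 fun j => (h t j).2)

theorem norm_hamField_sub_le {F G : (ZMod N → ℝ) × (ZMod N → ℝ) → ℝ}
    {z z' : (ZMod N → ℝ) × (ZMod N → ℝ)} {M : ℝ} (hM : 0 ≤ M)
    (h : ∀ w : (ZMod N → ℝ) × (ZMod N → ℝ), (∀ j, |w.1 j| ≤ 1) → (∀ j, |w.2 j| ≤ 1) →
      |fderiv ℝ F z w - fderiv ℝ G z' w| ≤ M) :
    ‖hamField F z - hamField G z'‖ ≤ M := by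
  have hs (i j : ZMod N) : |(Pi.single i 1 : ZMod N → ℝ) j| ≤ 1 := by
    rw [Pi.single_apply]; split_ifs <;> simp
  refine norm_prod_le_iff.2 ⟨(pi_norm_le_iff_of_nonneg hM).2 fun j => ?_,
    (pi_norm_le_iff_of_nonneg hM).2 fun j => ?_⟩
  · exact h _ (by simp) (hs j)
  · simpa [hamField, neg_add_eq_sub, abs_sub_comm] using
      h (Pi.single j 1, 0) (hs j) (by simp)

theorem abs_sum_zmod_le {f : ZMod N → ℝ} {M : ℝ} (h : ∀ j, |f j| ≤ M) :
    |∑ j, f j| ≤ N * M := by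
  refine (Finset.abs_sum_le_sum_abs _ _).trans
    ((Finset.sum_le_card_nsmul _ _ M fun j _ => h j).trans ?_)
  simp [ZMod.card]

theorem norm_hamField_Zham_sub_le {ε : ℝ} (hε : 0 ≤ ε) (z z' : (ZMod N → ℝ) × (ZMod N → ℝ)) :
    ‖hamField (Zham ε N) z - hamField (Zham ε N) z'‖ ≤ ε * (N * 4) * ‖z - z'‖ := by
  refine norm_hamField_sub_le (by positivity) fun w h1 h2 => ?_
  rw [fderiv_Zham_apply, fderiv_Zham_apply, ← mul_sub, ← Finset.sum_sub_distrib, abs_mul,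
    abs_of_nonneg hε, mul_assoc, mul_assoc]
  refine mul_le_mul_of_nonneg_left (abs_sum_zmod_le fun j => ?_) hε
  have hz1 (j : ZMod N) : |z.1 j - z'.1 j| ≤ ‖z - z'‖ :=
    (norm_le_pi_norm (z - z').1 j).trans (norm_fst_le _)
  have hz2 (j : ZMod N) : |z.2 j - z'.2 j| ≤ ‖z - z'‖ :=
    (norm_le_pi_norm (z - z').2 j).trans (norm_snd_le _)
  have key {a b : ℝ} (ha : |a| ≤ 1) (hb : |b| ≤ ‖z - z'‖) : |a * b| ≤ ‖z - z'‖ := by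
    rw [abs_mul]; nlinarith [abs_nonneg b]
  have k1 := abs_le.1 (key (h1 (j + 1)) (hz1 j))
  have k2 := abs_le.1 (key (h1 j) (hz1 (j + 1)))
  have k3 := abs_le.1 (key (h2 (j + 1)) (hz2 j))
  have k4 := abs_le.1 (key (h2 j) (hz2 (j + 1)))
  rw [abs_le]
  constructor <;> linarith

theorem abs_phi_sub_le {ν C r q p : ℝ} (hν : 0 ≤ ν) (hC : 0 ≤ C)
    (hσ : |sigmaFun (ν * (q ^ 2 + p ^ 2)) - 1| ≤ C * |ν * (q ^ 2 + p ^ 2)|)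
    (hq : |q| ≤ r) (hp : |p| ≤ r) :
    |q * sigmaFun (ν * (q ^ 2 + p ^ 2)) - q| ≤ 6 * ν * C * r ^ 3 := by
  have hr : 0 ≤ r := (abs_nonneg q).trans hq
  have hs : q ^ 2 + p ^ 2 ≤ 2 * r ^ 2 := by
    have := sq_le_sq' (abs_le.1 hq).1 (abs_le.1 hq).2
    have := sq_le_sq' (abs_le.1 hp).1 (abs_le.1 hp).2
    linarith
  rw [abs_of_nonneg (by positivity : 0 ≤ ν * (q ^ 2 + p ^ 2))] at hσ
  calc |q * sigmaFun (ν * (q ^ 2 + p ^ 2)) - q|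
      = |q| * |sigmaFun (ν * (q ^ 2 + p ^ 2)) - 1| := by rw [← abs_mul]; ring_nf
    _ ≤ r * (C * (ν * (2 * r ^ 2))) := by
      gcongr
      exact hσ.trans (by gcongr)
    _ ≤ 6 * ν * C * r ^ 3 := by
      have : 0 ≤ ν * C * r ^ 3 := by positivity
      linarith

theorem abs_dphi_sub_le {ν C r q p a b : ℝ} (hν : 0 ≤ ν) (hC : 0 ≤ C)
    (hσ : |sigmaFun (ν * (q ^ 2 + p ^ 2)) - 1| ≤ C * |ν * (q ^ 2 + p ^ 2)|)
    (hσ' : |deriv sigmaFun (ν * (q ^ 2 + p ^ 2))| ≤ C)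
    (hq : |q| ≤ r) (hp : |p| ≤ r) (ha : |a| ≤ 1) (hb : |b| ≤ 1) :
    |dphi ν q p a b - a| ≤ 6 * ν * C * r ^ 2 := by
  have hr : 0 ≤ r := (abs_nonneg q).trans hq
  have hs : q ^ 2 + p ^ 2 ≤ 2 * r ^ 2 := by
    have := sq_le_sq' (abs_le.1 hq).1 (abs_le.1 hq).2
    have := sq_le_sq' (abs_le.1 hp).1 (abs_le.1 hp).2
    linarith
  rw [abs_of_nonneg (by positivity : 0 ≤ ν * (q ^ 2 + p ^ 2))] at hσ
  have h4 : |2 * q * a + 2 * p * b| ≤ 2 * r * 1 + 2 * r * 1 := by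
    refine (abs_add_le _ _).trans ?_
    simp only [abs_mul, abs_two]
    gcongr
  calc |dphi ν q p a b - a|
      = |a * (sigmaFun (ν * (q ^ 2 + p ^ 2)) - 1) +
          q * (deriv sigmaFun (ν * (q ^ 2 + p ^ 2)) * (ν * (2 * q * a + 2 * p * b)))| := by
        unfold dphi; ring_nf
    _ ≤ |a| * |sigmaFun (ν * (q ^ 2 + p ^ 2)) - 1| +
          |q| * (|deriv sigmaFun (ν * (q ^ 2 + p ^ 2))| * (ν * |2 * q * a + 2 * p * b|)) := by
      refine (abs_add_le _ _).trans_eq ?_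
      simp only [abs_mul, abs_of_nonneg hν]
    _ ≤ 1 * (C * (ν * (2 * r ^ 2))) + r * (C * (ν * (2 * r * 1 + 2 * r * 1))) := by
      gcongr
      exact hσ.trans (by gcongr)
    _ = 6 * ν * C * r ^ 2 := by ring

theorem abs_mul_sub_mul_le {U u a q D r : ℝ} (hD : 0 ≤ D) (hDr : D * r ^ 2 ≤ 1)
    (hU : |U - a| ≤ D * r ^ 2) (hu : |u - q| ≤ D * r ^ 3) (ha : |a| ≤ 1) (hq : |q| ≤ r) :
    |U * u - a * q| ≤ 3 * D * r ^ 3 := by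
  have hr : 0 ≤ r := (abs_nonneg q).trans hq
  have hu' : |u| ≤ 2 * r := by
    have h := abs_add_le (u - q) q
    rw [sub_add_cancel] at h
    nlinarith
  calc |U * u - a * q| = |(U - a) * u + a * (u - q)| := by ring_nf
    _ ≤ |U - a| * |u| + |a| * |u - q| := by
      rw [← abs_mul, ← abs_mul]; exact abs_add_le _ _
    _ ≤ D * r ^ 2 * (2 * r) + 1 * (D * r ^ 3) := by gcongr
    _ = 3 * D * r ^ 3 := by ring

theorem norm_hamField_Kal_sub_Zham_le {ν ε δ C r : ℝ} (hν : 0 ≤ ν) (hε : 0 ≤ ε) (hC : 0 ≤ C)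
    (hr : 0 ≤ r)
    (hσ : ∀ s : ℝ, |s| < δ → |sigmaFun s - 1| ≤ C * |s| ∧ |deriv sigmaFun s| ≤ C)
    (hrδ : ν * (2 * r ^ 2) < δ) (hrC : 6 * ν * C * r ^ 2 ≤ 1)
    {z : (ZMod N → ℝ) × (ZMod N → ℝ)} (h1 : ∀ j, |z.1 j| ≤ r) (h2 : ∀ j, |z.2 j| ≤ r) :
    ‖hamField (Kal ν ε N) z - hamField (Zham ε N) z‖ ≤
      ε * (N * (4 * (3 * (6 * ν * C) * r ^ 3))) := by
  refine norm_hamField_sub_le (by positivity) fun w k1 k2 => ?_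
  have hs (j : ZMod N) : |ν * (z.1 j ^ 2 + z.2 j ^ 2)| < δ := by
    rw [abs_of_nonneg (by positivity)]
    refine lt_of_le_of_lt (mul_le_mul_of_nonneg_left ?_ hν) hrδ
    have := sq_le_sq' (abs_le.1 (h1 j)).1 (abs_le.1 (h1 j)).2
    have := sq_le_sq' (abs_le.1 (h2 j)).1 (abs_le.1 (h2 j)).2
    linarith
  have hs' (j : ZMod N) : |ν * (z.2 j ^ 2 + z.1 j ^ 2)| < δ := by
    rw [add_comm]; exact hs j
  have u1 (j : ZMod N) := abs_phi_sub_le hν hC (hσ _ (hs j)).1 (h1 j) (h2 j)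
  have u2 (j : ZMod N) := abs_phi_sub_le hν hC (hσ _ (hs' j)).1 (h2 j) (h1 j)
  have d1 (j : ZMod N) :=
    abs_dphi_sub_le hν hC (hσ _ (hs j)).1 (hσ _ (hs j)).2 (h1 j) (h2 j) (k1 j) (k2 j)
  have d2 (j : ZMod N) :=
    abs_dphi_sub_le hν hC (hσ _ (hs' j)).1 (hσ _ (hs' j)).2 (h2 j) (h1 j) (k2 j) (k1 j)
  have hD : 0 ≤ 6 * ν * C := by positivity
  rw [fderiv_Kal_apply, fderiv_Zham_apply, ← mul_sub, ← Finset.sum_sub_distrib, abs_mul,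
    abs_of_nonneg hε]
  refine mul_le_mul_of_nonneg_left (abs_sum_zmod_le fun j => ?_) hε
  simp only [add_comm (z.2 _ ^ 2)] at u2
  have e1 := abs_le.1 (abs_mul_sub_mul_le hD hrC (d1 (j + 1)) (u1 j) (k1 _) (h1 _))
  have e2 := abs_le.1 (abs_mul_sub_mul_le hD hrC (d1 j) (u1 (j + 1)) (k1 _) (h1 _))
  have e3 := abs_le.1 (abs_mul_sub_mul_le hD hrC (d2 (j + 1)) (u2 j) (k2 _) (h2 _))
  have e4 := abs_le.1 (abs_mul_sub_mul_le hD hrC (d2 j) (u2 (j + 1)) (k2 _) (h2 _))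
  rw [abs_le]
  constructor <;> linarith

theorem norm_sub_le_gronwallBound_of_nonneg {E : Type*} [NormedAddCommGroup E] [NormedSpace ℝ E]
    {v : E → E} {L : NNReal} {e : ℝ} {x y x' : ℝ → E} (hv : LipschitzWith L v)
    (hx : ∀ t, HasDerivAt x (x' t) t) (hy : ∀ t, HasDerivAt y (v (y t)) t)
    (he : ∀ t, ‖x' t - v (x t)‖ ≤ e) {t : ℝ} (ht : 0 ≤ t) :
    ‖x t - y t‖ ≤ gronwallBound ‖x 0 - y 0‖ L e t := by
  have h := dist_le_of_approx_trajectories_ODE (v := fun _ => v) (a := 0) (b := t) (εf := e)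
    (εg := 0) (δ := ‖x 0 - y 0‖) (fun _ => hv)
    (fun s _ => (hx s).continuousAt.continuousWithinAt) (fun s _ => (hx s).hasDerivWithinAt)
    (fun s _ => by rw [dist_eq_norm]; exact he s)
    (fun s _ => (hy s).continuousAt.continuousWithinAt) (fun s _ => (hy s).hasDerivWithinAt)
    (fun s _ => by simp) (by rw [dist_eq_norm]) t ⟨ht, le_rfl⟩
  simpa [dist_eq_norm] using h

theorem norm_sub_le_gronwallBound_abs {E : Type*} [NormedAddCommGroup E] [NormedSpace ℝ E]
    {v : E → E} {L : NNReal} {e : ℝ} {x y x' : ℝ → E} (hv : LipschitzWith L v)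
    (hx : ∀ t, HasDerivAt x (x' t) t) (hy : ∀ t, HasDerivAt y (v (y t)) t)
    (he : ∀ t, ‖x' t - v (x t)‖ ≤ e) (t : ℝ) :
    ‖x t - y t‖ ≤ gronwallBound ‖x 0 - y 0‖ L e |t| := by
  rcases le_total 0 t with ht | ht
  · rw [abs_of_nonneg ht]
    exact norm_sub_le_gronwallBound_of_nonneg hv hx hy he ht
  · rw [abs_of_nonpos ht]
    have hrev {f : ℝ → E} {f' : E} (s : ℝ) (hf : HasDerivAt f f' (-s)) :
        HasDerivAt (fun s => f (-s)) (-f') s := by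
      rw [← neg_one_smul ℝ f']
      exact hf.scomp s (hasDerivAt_neg s)
    have h := norm_sub_le_gronwallBound_of_nonneg (x := fun s => x (-s)) (y := fun s => y (-s))
      (v := fun z => -v z) (x' := fun s => -x' (-s)) hv.neg (fun s => hrev s (hx _))
      (fun s => hrev s (hy _)) (e := e)
      (fun s => by rw [← norm_neg]; simpa [neg_add_eq_sub, norm_sub_rev] using he (-s))
      (neg_nonneg.2 ht)
    simpa using h

theorem norm_prod_le_sqrt_sum_sq (z : (ZMod N → ℝ) × (ZMod N → ℝ)) :
    ‖z‖ ≤ √(∑ j, (z.1 j ^ 2 + z.2 j ^ 2)) := by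
  have h (j : ZMod N) : z.1 j ^ 2 + z.2 j ^ 2 ≤ ∑ j, (z.1 j ^ 2 + z.2 j ^ 2) :=
    Finset.single_le_sum (f := fun j => z.1 j ^ 2 + z.2 j ^ 2) (fun _ _ => by positivity)
      (Finset.mem_univ j)
  refine norm_prod_le_iff.2 ⟨(pi_norm_le_iff_of_nonneg (Real.sqrt_nonneg _)).2 fun j => ?_,
    (pi_norm_le_iff_of_nonneg (Real.sqrt_nonneg _)).2 fun j => ?_⟩
  · exact Real.abs_le_sqrt (by nlinarith [h j])
  · exact Real.abs_le_sqrt (by nlinarith [h j])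

theorem sqrt_sum_sq_le_norm_prod (z : (ZMod N → ℝ) × (ZMod N → ℝ)) :
    √(∑ j, (z.1 j ^ 2 + z.2 j ^ 2)) ≤ 2 * N * ‖z‖ := by
  have hN : (1 : ℝ) ≤ N := by exact_mod_cast NeZero.one_le
  have h (j : ZMod N) : |z.1 j ^ 2 + z.2 j ^ 2| ≤ 2 * ‖z‖ ^ 2 := by
    have a1 : |z.1 j| ≤ ‖z‖ := (norm_le_pi_norm z.1 j).trans (norm_fst_le z)
    have a2 : |z.2 j| ≤ ‖z‖ := (norm_le_pi_norm z.2 j).trans (norm_snd_le z)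
    rw [abs_of_nonneg (by positivity), ← sq_abs (z.1 j), ← sq_abs (z.2 j)]
    nlinarith [abs_nonneg (z.1 j), abs_nonneg (z.2 j)]
  refine Real.sqrt_le_iff.2 ⟨by positivity, ((le_abs_self _).trans (abs_sum_zmod_le h)).trans ?_⟩
  have hpos : 0 ≤ N * ‖z‖ ^ 2 := by positivity
  nlinarith [mul_nonneg (sub_nonneg.2 hN) hpos]

end

/-- Closeness of the Ablowitz-Ladik dynamics to the dNLS dynamics in Darboux
coordinates: `‖z(t) − ζ(t)‖ ≤ c₀'·(‖z(0) − ζ(0)‖ + ρ³/ε)` for `|t| ≤ ε⁻¹`, for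
solutions of `ż = J∇K(z)` and `ζ̇ = J∇Z(ζ)` with initial data of norm at most
`ρ ≤ ρ₀`. -/
theorem stmt16 (ν : ℝ) (hν : 0 < ν) (N : ℕ) [NeZero N] (hN : 2 ≤ N) :
    ∃ c₀' > (0 : ℝ), ∃ ρ₀ > (0 : ℝ), ∀ ρ : ℝ, 0 < ρ → ρ ≤ ρ₀ →
      ∀ ε : ℝ, 0 < ε → ε ≤ 1 →
      ∀ Qz Pz Qζ Pζ : ℝ → ZMod N → ℝ,
        IsHamSol (Kal ν ε N) Qz Pz →
        IsHamSol (Zham ε N) Qζ Pζ →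
        Real.sqrt (∑ j : ZMod N, ((Qz 0 j) ^ 2 + (Pz 0 j) ^ 2)) ≤ ρ →
        Real.sqrt (∑ j : ZMod N, ((Qζ 0 j) ^ 2 + (Pζ 0 j) ^ 2)) ≤ ρ →
        ∀ t : ℝ, |t| ≤ ε⁻¹ →
          Real.sqrt (∑ j : ZMod N, ((Qz t j - Qζ t j) ^ 2 + (Pz t j - Pζ t j) ^ 2))
            ≤ c₀' * (Real.sqrt (∑ j : ZMod N,
                ((Qz 0 j - Qζ 0 j) ^ 2 + (Pz 0 j - Pζ 0 j) ^ 2)) + ρ ^ 3 / ε) := by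
  obtain ⟨δ, hδ, C, hC, hσ⟩ := exists_sigmaFun_bounds
  have hN0 : (0 : ℝ) < N := by exact_mod_cast NeZero.pos N
  refine ⟨2 * N * Real.exp (N * 4) * (1 + 3 * (6 * ν * C)), by positivity,
    min 1 (min (δ / (4 * ν)) (1 / (6 * ν * C))), by positivity, ?_⟩
  intro ρ hρ hρ₀ ε hε hε1 Qz Pz Qζ Pζ hz hζ hz0 _ t ht
  obtain ⟨hρ1, hρ2⟩ := le_min_iff.1 hρ₀
  obtain ⟨hρ2, hρ3⟩ := le_min_iff.1 hρ2
  rw [le_div_iff₀ (by positivity)] at hρ2 hρ3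
  have hρsq : ρ ^ 2 ≤ ρ := by nlinarith
  have hrδ : ν * (2 * ρ ^ 2) < δ := by nlinarith [mul_le_mul_of_nonneg_left hρsq hν.le]
  have hrC : 6 * ν * C * ρ ^ 2 ≤ 1 := by
    nlinarith [mul_le_mul_of_nonneg_left hρsq (by positivity : 0 ≤ 6 * ν * C)]
  have hbound (s : ℝ) : ‖(Qz s, Pz s)‖ ≤ ρ := by
    refine (norm_prod_le_sqrt_sum_sq _).trans ?_
    rw [sum_sq_eq_of_isHamSol (fderiv_Kal_rotation ν ε) hz s]
    exact hz0
  have hfield (s : ℝ) := norm_hamField_Kal_sub_Zham_le (z := (Qz s, Pz s)) hν.le hε.le hC.le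
    hρ.le hσ hrδ hrC
    (fun j => ((norm_le_pi_norm (Qz s) j).trans (norm_fst_le (Qz s, Pz s))).trans (hbound s))
    (fun j => ((norm_le_pi_norm (Pz s) j).trans (norm_snd_le (Qz s, Pz s))).trans (hbound s))
  have hL0 : 0 < ε * (N * 4) := by positivity
  have hv : LipschitzWith (ε * (N * 4)).toNNReal (hamField (Zham ε N)) :=
    LipschitzWith.of_dist_le_mul fun z z' => by
      rw [dist_eq_norm, dist_eq_norm, Real.coe_toNNReal _ hL0.le]
      exact norm_hamField_Zham_sub_le hε.le z z'
  have hgr := norm_sub_le_gronwallBound_abs hv hz.hasDerivAt hζ.hasDerivAt hfield t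
  rw [Real.coe_toNNReal _ hL0.le, gronwallBound_of_K_ne_0 hL0.ne'] at hgr
  have hexp : Real.exp (ε * (N * 4) * |t|) ≤ Real.exp (N * 4) := by
    refine Real.exp_le_exp.2 ?_
    have : ε * |t| ≤ 1 := by
      have := mul_le_mul_of_nonneg_left ht hε.le
      rwa [mul_inv_cancel₀ hε.ne'] at this
    nlinarith
  have hquot : ε * (N * (4 * (3 * (6 * ν * C) * ρ ^ 3))) / (ε * (N * 4)) =
      3 * (6 * ν * C) * ρ ^ 3 := by
    field_simp
  have hρε : ρ ^ 3 ≤ ρ ^ 3 / ε := le_div_self (by positivity) hε hε1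
  have h0 := norm_prod_le_sqrt_sum_sq ((Qz 0, Pz 0) - (Qζ 0, Pζ 0))
  have h1 := sqrt_sum_sq_le_norm_prod ((Qz t, Pz t) - (Qζ t, Pζ t))
  simp only [Prod.fst_sub, Prod.snd_sub, Pi.sub_apply] at h0 h1
  rw [hquot] at hgr
  set d₀ := √(∑ j, ((Qz 0 j - Qζ 0 j) ^ 2 + (Pz 0 j - Pζ 0 j) ^ 2))
  have hd₀ : 0 ≤ d₀ := Real.sqrt_nonneg _
  have hD : 0 ≤ 3 * (6 * ν * C) := by positivity
  calc _ ≤ 2 * N * ‖(Qz t, Pz t) - (Qζ t, Pζ t)‖ := h1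
    _ ≤ 2 * N * (d₀ * Real.exp (N * 4) +
          3 * (6 * ν * C) * (ρ ^ 3 / ε) * Real.exp (N * 4)) := by
      refine mul_le_mul_of_nonneg_left (hgr.trans ?_) (by positivity)
      refine add_le_add (mul_le_mul h0 hexp (Real.exp_nonneg _) hd₀) ?_
      exact (mul_le_mul_of_nonneg_left ((sub_le_self _ zero_le_one).trans hexp)
        (by positivity)).trans (by gcongr)
    _ = 2 * N * Real.exp (N * 4) * (d₀ + 3 * (6 * ν * C) * (ρ ^ 3 / ε)) := by ring
    _ ≤ 2 * N * Real.exp (N * 4) * ((1 + 3 * (6 * ν * C)) * (d₀ + ρ ^ 3 / ε)) := by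
      gcongr
      nlinarith [mul_nonneg hD hd₀, (by positivity : 0 ≤ ρ ^ 3 / ε)]
    _ = _ := by ring
end
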